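/- There exist a bounded open set Ω ⊂ ℝ² diffeomorphic to an annulus (in particular not simply connected), which is not rotationally symmetric about any point, and a real analytic function u on an open neighborhood of the closure of Ω, positive on Ω and not radial with respect to any point, such that det D²u + 2Δu + 4 = 0 in Ω and u = 0, |Du| = 2 on ∂Ω. In particular, the simple connectedness hypothesis in the main theorem cannot be removed: the fully nonlinear operator F(M) = det M + 2 tr M + 4 is rotationally invariant and real analytic, yet admits a non-radial real analytic solution of the overdetermined problem on an annulus. -/

import Mathlib

open Set Metric Topology Asymptotics MvPolynomial Matrix

/-- Partial derivative with respect to the first variable. -/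
noncomputable def pdx (f : ℝ × ℝ → ℝ) (p : ℝ × ℝ) : ℝ :=
  deriv (fun x => f (x, p.2)) p.1

/-- Partial derivative with respect to the second variable. -/
noncomputable def pdy (f : ℝ × ℝ → ℝ) (p : ℝ × ℝ) : ℝ :=
  deriv (fun y => f (p.1, y)) p.2

/-- The Laplacian `Δu = u_xx + u_yy`. -/
noncomputable def lap (f : ℝ × ℝ → ℝ) (p : ℝ × ℝ) : ℝ :=
  pdx (pdx f) p + pdy (pdy f) p

/-- The Hessian determinant `det D²u = u_xx u_yy - u_xy²`. -/
noncomputable def hessDet (f : ℝ × ℝ → ℝ) (p : ℝ × ℝ) : ℝ :=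
  pdx (pdx f) p * pdy (pdy f) p - (pdx (pdy f) p) ^ 2

/-- The Jacobian `J[f,g] = f_x g_y - f_y g_x`. -/
noncomputable def jacDet (f g : ℝ × ℝ → ℝ) (p : ℝ × ℝ) : ℝ :=
  pdx f p * pdy g p - pdy f p * pdx g p

open scoped ContDiff

theorem pdx_eq_of_hasFDerivAt {f : ℝ × ℝ → ℝ} {L : ℝ × ℝ →L[ℝ] ℝ} {p : ℝ × ℝ}
    (h : HasFDerivAt f L p) : pdx f p = L (1, 0) := by
  have hc : HasDerivAt (fun x : ℝ => (x, p.2)) ((1 : ℝ), (0 : ℝ)) p.1 :=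
    (hasDerivAt_id p.1).prodMk (hasDerivAt_const p.1 p.2)
  exact (HasFDerivAt.comp_hasDerivAt (l := f) p.1 h hc).deriv

theorem pdy_eq_of_hasFDerivAt {f : ℝ × ℝ → ℝ} {L : ℝ × ℝ →L[ℝ] ℝ} {p : ℝ × ℝ}
    (h : HasFDerivAt f L p) : pdy f p = L (0, 1) := by
  have hc : HasDerivAt (fun y : ℝ => (p.1, y)) ((0 : ℝ), (1 : ℝ)) p.2 :=
    (hasDerivAt_const p.2 p.1).prodMk (hasDerivAt_id p.2)
  exact (HasFDerivAt.comp_hasDerivAt (l := f) p.2 h hc).deriv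

/-- A space mapping continuously to `ℂ \ {0}` so that some loop winds once around the origin
is not simply connected. -/
theorem not_simplyConnectedSpace_of_winding_loop {A : Type*} [TopologicalSpace A]
    [LocallyPathConnectedSpace A] (f : C(A, {z : ℂ // z ≠ 0})) (k : ℝ → A) (hk : Continuous k)
    (hper : k (2 * Real.pi) = k 0) (c : ℂ)
    (h : ∀ t : ℝ, (f (k t) : ℂ) = c * Complex.exp (t * Complex.I)) :
    ¬SimplyConnectedSpace A := by
  intro _
  obtain ⟨e, he⟩ : ∃ e : ℂ, Complex.exp e = f (k 0) :=
    ⟨Complex.log (f (k 0)), Complex.exp_log (f (k 0)).2⟩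
  obtain ⟨F, ⟨hF0, hF⟩, -⟩ :=
    Complex.isCoveringMap_exp.existsUnique_continuousMap_lifts f (k 0) e (Subtype.ext he)
  have hc : c = Complex.exp e := by rw [he, h 0]; simp
  have key : (fun t : ℝ => F (k t)) = fun t : ℝ => e + t * Complex.I := by
    refine Complex.isCoveringMap_exp.eq_of_comp_eq (by fun_prop) (by fun_prop) ?_ 0 ?_
    · funext t
      apply Subtype.ext
      have h1 : Complex.exp (F (k t)) = f (k t) := congrArg Subtype.val (congrFun hF (k t))
      simp only [Function.comp_apply, h1, h t, hc, Complex.exp_add]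
    · simp [hF0]
  have h2 := congrFun key (2 * Real.pi)
  simp [hper, hF0, Real.pi_ne_zero] at h2

/-- The Euclidean norm on `ℝ × ℝ`. -/
noncomputable def radius (q : ℝ × ℝ) : ℝ := √(q.1 ^ 2 + q.2 ^ 2)

/-- The first coordinate of the unit vector `q / |q|`. -/
noncomputable def dirX (q : ℝ × ℝ) : ℝ := q.1 / radius q

/-- The second coordinate of the unit vector `q / |q|`. -/
noncomputable def dirY (q : ℝ × ℝ) : ℝ := q.2 / radius q

/-- The linear functional with coordinates `a, b`. -/
noncomputable def functional (a b : ℝ) : ℝ × ℝ →L[ℝ] ℝ :=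
  a • ContinuousLinearMap.fst ℝ ℝ ℝ + b • ContinuousLinearMap.snd ℝ ℝ ℝ

@[simp]
theorem functional_apply (a b : ℝ) (v : ℝ × ℝ) : functional a b v = a * v.1 + b * v.2 := by
  simp [functional]

/-- The linear map with eigenvalue `1` along `(a, b)` and `m` along `(-b, a)`, when `(a, b)` is
a unit vector. -/
noncomputable def stretch (a b m : ℝ) : ℝ × ℝ →L[ℝ] ℝ × ℝ :=
  (functional (a ^ 2 + m * b ^ 2) ((1 - m) * (a * b))).prod
    (functional ((1 - m) * (a * b)) (b ^ 2 + m * a ^ 2))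

theorem stretch_apply (a b m : ℝ) (v : ℝ × ℝ) :
    stretch a b m v = ((a ^ 2 + m * b ^ 2) * v.1 + (1 - m) * (a * b) * v.2,
      (1 - m) * (a * b) * v.1 + (b ^ 2 + m * a ^ 2) * v.2) := by
  simp [stretch]

theorem stretch_stretch_inv {a b m m' : ℝ} (hab : a ^ 2 + b ^ 2 = 1) (hm : m * m' = 1)
    (v : ℝ × ℝ) : stretch a b m (stretch a b m' v) = v := by
  simp only [stretch_apply]
  ext
  · simp only
    linear_combination (v.1 * (a ^ 2 + b ^ 2 + 1) + (v.2 * a - v.1 * b) * b * (1 - m * m')) * hab +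
      (b ^ 2 * v.1 - a * b * v.2) * hm
  · simp only
    linear_combination (v.2 * (a ^ 2 + b ^ 2 + 1) + (v.1 * b - v.2 * a) * a * (1 - m * m')) * hab +
      (a ^ 2 * v.2 - a * b * v.1) * hm

/-- `stretch` as a continuous linear equivalence. -/
noncomputable def stretchEquiv (a b m : ℝ) (hab : a ^ 2 + b ^ 2 = 1) (hm : m ≠ 0) :
    (ℝ × ℝ) ≃L[ℝ] ℝ × ℝ :=
  ContinuousLinearEquiv.equivOfInverse (stretch a b m) (stretch a b m⁻¹)
    (stretch_stretch_inv hab (inv_mul_cancel₀ hm)) (stretch_stretch_inv hab (mul_inv_cancel₀ hm))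

theorem radius_pos {q : ℝ × ℝ} (hq : q ≠ 0) : 0 < radius q := by
  apply Real.sqrt_pos.2
  by_contra! h
  exact hq (Prod.ext (by simp; nlinarith [sq_nonneg q.1, sq_nonneg q.2])
    (by simp; nlinarith [sq_nonneg q.1, sq_nonneg q.2]))

theorem ne_zero_of_radius_pos {q : ℝ × ℝ} (hq : 0 < radius q) : q ≠ 0 := by
  rintro rfl
  simp [radius] at hq

theorem radius_sq (q : ℝ × ℝ) : radius q ^ 2 = q.1 ^ 2 + q.2 ^ 2 :=
  Real.sq_sqrt (by positivity)

theorem dirX_sq_add_dirY_sq {q : ℝ × ℝ} (hq : q ≠ 0) : dirX q ^ 2 + dirY q ^ 2 = 1 := by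
  have := radius_pos hq
  simp only [dirX, dirY]
  field_simp
  exact (radius_sq q).symm

theorem radius_mul_dirX {q : ℝ × ℝ} (hq : q ≠ 0) : radius q * dirX q = q.1 :=
  mul_div_cancel₀ _ (radius_pos hq).ne'

theorem radius_mul_dirY {q : ℝ × ℝ} (hq : q ≠ 0) : radius q * dirY q = q.2 :=
  mul_div_cancel₀ _ (radius_pos hq).ne'

theorem hasFDerivAt_radius {q : ℝ × ℝ} (hq : q ≠ 0) :
    HasFDerivAt radius (functional (dirX q) (dirY q)) q := by
  have hr := radius_pos hq
  have h := ((hasFDerivAt_fst (𝕜 := ℝ) (p := q)).pow 2).add ((hasFDerivAt_snd (p := q)).pow 2)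
  have h2 := h.sqrt (by
    have := radius_sq q
    simp only [Pi.add_apply]
    rw [← this]; positivity)
  refine h2.congr_fderiv ?_
  ext <;> simp [dirX, dirY, radius] <;> ring

theorem hasFDerivAt_fun_div {f g : ℝ × ℝ → ℝ} {f' g' : ℝ × ℝ →L[ℝ] ℝ} {q : ℝ × ℝ}
    (hf : HasFDerivAt f f' q) (hg : HasFDerivAt g g' q) (hq : g q ≠ 0) :
    HasFDerivAt (fun x => f x / g x) ((g q)⁻¹ • f' - (f q / g q ^ 2) • g') q := by
  simp only [div_eq_mul_inv]
  refine (hf.mul ((hasDerivAt_inv hq).comp_hasFDerivAt q hg)).congr_fderiv ?_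
  ext <;> simp <;> ring

theorem hasFDerivAt_dirX {q : ℝ × ℝ} (hq : q ≠ 0) :
    HasFDerivAt dirX ((dirY q / radius q) • functional (dirY q) (-dirX q)) q := by
  have hr := radius_pos hq
  have h := hasFDerivAt_fun_div (hasFDerivAt_fst (𝕜 := ℝ) (p := q)) (hasFDerivAt_radius hq) hr.ne'
  refine h.congr_fderiv ?_
  have h1 := radius_mul_dirX hq
  have h2 := dirX_sq_add_dirY_sq hq
  ext <;> simp
  · field_simp
    linear_combination -radius q * h2 + dirX q * h1
  · field_simp
    rw [← h1]
    field_simp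

theorem hasFDerivAt_dirY {q : ℝ × ℝ} (hq : q ≠ 0) :
    HasFDerivAt dirY ((dirX q / radius q) • functional (-dirY q) (dirX q)) q := by
  have hr := radius_pos hq
  have h := hasFDerivAt_fun_div (hasFDerivAt_snd (𝕜 := ℝ) (p := q)) (hasFDerivAt_radius hq) hr.ne'
  refine h.congr_fderiv ?_
  have h1 := radius_mul_dirY hq
  have h2 := dirX_sq_add_dirY_sq hq
  ext <;> simp
  · field_simp
    rw [← h1]
    field_simp
  · field_simp
    linear_combination -radius q * h2 + dirY q * h1

theorem contDiffAt_radius {n : WithTop ℕ∞} {q : ℝ × ℝ} (hq : q ≠ 0) : ContDiffAt ℝ n radius q := by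
  refine ContDiffAt.sqrt (by fun_prop) ?_
  rw [← radius_sq]
  exact pow_ne_zero 2 (radius_pos hq).ne'

theorem contDiffAt_dirX {n : WithTop ℕ∞} {q : ℝ × ℝ} (hq : q ≠ 0) : ContDiffAt ℝ n dirX q :=
  contDiffAt_fst.div (contDiffAt_radius hq) (radius_pos hq).ne'

theorem contDiffAt_dirY {n : WithTop ℕ∞} {q : ℝ × ℝ} (hq : q ≠ 0) : ContDiffAt ℝ n dirY q :=
  contDiffAt_snd.div (contDiffAt_radius hq) (ne_of_gt (radius_pos hq))

/-- The map `q ↦ q + ∇H(q)` with `H(q) = q.1 ^ 2 / (4 |q|)`, which sends the circle of radius `r`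
about the origin to the convex curve with support function `r + cos² θ / 4`. -/
noncomputable def bend (q : ℝ × ℝ) : ℝ × ℝ :=
  (q.1 + (2 * dirX q - dirX q ^ 3) / 4, q.2 - dirX q ^ 2 * dirY q / 4)

theorem contDiffAt_bend {n : WithTop ℕ∞} {q : ℝ × ℝ} (hq : q ≠ 0) : ContDiffAt ℝ n bend q := by
  have hX : ContDiffAt ℝ n dirX q := contDiffAt_dirX hq
  have hY : ContDiffAt ℝ n dirY q := contDiffAt_dirY hq
  exact (contDiffAt_fst.add (((contDiffAt_const.mul hX).sub (hX.pow 3)).div_const 4)).prodMk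
    (contDiffAt_snd.sub (((hX.pow 2).mul hY).div_const 4))

/-- The factor by which `bend` stretches lengths in the angular direction. -/
noncomputable def angularFactor (q : ℝ × ℝ) : ℝ := 1 + (2 - 3 * dirX q ^ 2) / (4 * radius q)

theorem angularFactor_pos {q : ℝ × ℝ} (hq : 1 < radius q) : 0 < angularFactor q := by
  have hq0 := ne_zero_of_radius_pos (one_pos.trans hq)
  have h : dirX q ^ 2 ≤ 1 := by nlinarith [dirX_sq_add_dirY_sq hq0, sq_nonneg (dirY q)]
  have : angularFactor q = (4 * radius q + 2 - 3 * dirX q ^ 2) / (4 * radius q) := by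
    have := one_pos.trans hq
    rw [angularFactor]
    field_simp
    ring
  rw [this]
  exact div_pos (by linarith) (by linarith)

theorem hasFDerivAt_bend {q : ℝ × ℝ} (hq : q ≠ 0) :
    HasFDerivAt bend (stretch (dirX q) (dirY q) (angularFactor q)) q := by
  have hX := hasFDerivAt_dirX hq
  have hY := hasFDerivAt_dirY hq
  have hr := radius_pos hq
  have hab := dirX_sq_add_dirY_sq hq
  have h1 := (hasFDerivAt_fst (𝕜 := ℝ) (p := q)).add
    (((hX.const_mul 2).sub (hX.pow 3)).mul_const 4⁻¹)
  have h2 := (hasFDerivAt_snd (𝕜 := ℝ) (p := q)).sub (((hX.pow 2).mul hY).mul_const 4⁻¹)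
  refine (h1.prodMk h2).congr_fderiv ?_
  ext <;> simp [stretch, angularFactor] <;> field_simp
  · linear_combination (-4 * radius q) * hab
  · linear_combination (-2 * dirX q * dirY q) * hab
  · ring
  · linear_combination (-4 * radius q + 2 * dirX q ^ 2) * hab

theorem eq_of_support_eq {r r' a a' b b' : ℝ} (hr : 1 < r) (hr' : 1 < r')
    (h : a ^ 2 + b ^ 2 = 1) (h' : a' ^ 2 + b' ^ 2 = 1)
    (hx : r * a + (2 * a - a ^ 3) / 4 = r' * a' + (2 * a' - a' ^ 3) / 4)
    (hy : r * b - a ^ 2 * b / 4 = r' * b' - a' ^ 2 * b' / 4) :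
    r * a = r' * a' ∧ r * b = r' * b' := by
  have ha : a ^ 2 ≤ 1 := by nlinarith
  have ha' : a' ^ 2 ≤ 1 := by nlinarith
  have hb' : b' ^ 2 ≤ 1 := by nlinarith
  have hX : (r * a - r' * a') ^ 2 ≤ (a - a') ^ 2 / 4 := by
    have e : r * a - r' * a' = -(a - a') * (2 - (a ^ 2 + a * a' + a' ^ 2)) / 4 := by linarith
    have h1 : (2 - (a ^ 2 + a * a' + a' ^ 2)) ^ 2 ≤ 2 ^ 2 := by
      apply sq_le_sq'
      · nlinarith [sq_nonneg (a - a')]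
      · nlinarith [sq_nonneg (a + a')]
    rw [e]
    nlinarith [mul_le_mul_of_nonneg_left h1 (sq_nonneg (a - a'))]
  have hY : (r * b - r' * b') ^ 2 ≤ ((b - b') ^ 2 + 4 * (a - a') ^ 2) / 8 := by
    have e : r * b - r' * b' = (a ^ 2 * (b - b') + b' * (a + a') * (a - a')) / 4 := by linarith
    have h1 : (a ^ 2 * (b - b')) ^ 2 ≤ (b - b') ^ 2 := by
      have : (a ^ 2) ^ 2 ≤ 1 := by nlinarith [sq_nonneg a]
      nlinarith [mul_le_mul_of_nonneg_left this (sq_nonneg (b - b'))]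
    have h2 : (b' * (a + a') * (a - a')) ^ 2 ≤ 4 * (a - a') ^ 2 := by
      have h3 : (a + a') ^ 2 ≤ 4 := by nlinarith [sq_nonneg (a - a')]
      have : b' ^ 2 * (a + a') ^ 2 ≤ 4 := by nlinarith [sq_nonneg (a + a')]
      nlinarith [mul_le_mul_of_nonneg_left this (sq_nonneg (a - a'))]
    rw [e]
    nlinarith [sq_nonneg (a ^ 2 * (b - b') - b' * (a + a') * (a - a'))]
  have hlow : (a - a') ^ 2 + (b - b') ^ 2 ≤ (r * a - r' * a') ^ 2 + (r * b - r' * b') ^ 2 := by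
    have e : (r * a - r' * a') ^ 2 + (r * b - r' * b') ^ 2 =
        (r - r') ^ 2 + r * r' * ((a - a') ^ 2 + (b - b') ^ 2) := by
      linear_combination (r ^ 2 - r * r') * h + (r' ^ 2 - r * r') * h'
    have : 1 ≤ r * r' := by nlinarith
    rw [e]
    have h1 := le_mul_of_one_le_left (add_nonneg (sq_nonneg (a - a')) (sq_nonneg (b - b'))) this
    linarith [sq_nonneg (r - r')]
  have ea : (a - a') ^ 2 = 0 := by linarith [sq_nonneg (a - a'), sq_nonneg (b - b')]
  have eb : (b - b') ^ 2 = 0 := by linarith [sq_nonneg (a - a'), sq_nonneg (b - b')]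
  constructor
  · have : (r * a - r' * a') ^ 2 = 0 := by linarith [sq_nonneg (r * a - r' * a')]
    exact sub_eq_zero.1 (pow_eq_zero_iff two_ne_zero |>.1 this)
  · have : (r * b - r' * b') ^ 2 = 0 := by linarith [sq_nonneg (r * b - r' * b')]
    exact sub_eq_zero.1 (pow_eq_zero_iff two_ne_zero |>.1 this)

theorem bend_injOn : InjOn bend {q | 1 < radius q} := by
  intro q hq q' hq' h
  have h0 := ne_zero_of_radius_pos (one_pos.trans hq)
  have h0' := ne_zero_of_radius_pos (one_pos.trans hq')
  have hx := congrArg Prod.fst h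
  have hy := congrArg Prod.snd h
  simp only [bend] at hx hy
  have := eq_of_support_eq hq hq' (dirX_sq_add_dirY_sq h0) (dirX_sq_add_dirY_sq h0')
    (by rwa [radius_mul_dirX h0, radius_mul_dirX h0'])
    (by rwa [radius_mul_dirY h0, radius_mul_dirY h0'])
  rw [radius_mul_dirX h0, radius_mul_dirX h0', radius_mul_dirY h0, radius_mul_dirY h0'] at this
  exact Prod.ext this.1 this.2

/-- The inverse of `bend` on the exterior of the unit disk. -/
noncomputable def unbend : ℝ × ℝ → ℝ × ℝ := Function.invFunOn bend {q | 1 < radius q}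

theorem unbend_bend {q : ℝ × ℝ} (hq : 1 < radius q) : unbend (bend q) = q :=
  bend_injOn.leftInvOn_invFunOn hq

theorem continuous_radius : Continuous radius := by
  unfold radius
  fun_prop

theorem isOpen_one_lt_radius : IsOpen {q | 1 < radius q} :=
  isOpen_lt continuous_const continuous_radius

theorem eventually_unbend_bend {q : ℝ × ℝ} (hq : 1 < radius q) :
    ∀ᶠ x in 𝓝 q, unbend (bend x) = x :=
  (isOpen_one_lt_radius.eventually_mem hq).mono fun _ => unbend_bend

theorem hasFDerivAt_bend_equiv {q : ℝ × ℝ} (hq : 1 < radius q) :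
    HasFDerivAt bend (stretchEquiv (dirX q) (dirY q) (angularFactor q)
      (dirX_sq_add_dirY_sq (ne_zero_of_radius_pos (one_pos.trans hq)))
      (angularFactor_pos hq).ne' : ℝ × ℝ →L[ℝ] ℝ × ℝ) q :=
  hasFDerivAt_bend (ne_zero_of_radius_pos (one_pos.trans hq))

theorem hasStrictFDerivAt_bend_equiv {q : ℝ × ℝ} (hq : 1 < radius q) :
    HasStrictFDerivAt bend (stretchEquiv (dirX q) (dirY q) (angularFactor q)
      (dirX_sq_add_dirY_sq (ne_zero_of_radius_pos (one_pos.trans hq)))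
      (angularFactor_pos hq).ne' : ℝ × ℝ →L[ℝ] ℝ × ℝ) q :=
  (contDiffAt_bend (n := ω) (ne_zero_of_radius_pos (one_pos.trans hq))).hasStrictFDerivAt'
    (hasFDerivAt_bend_equiv hq) (by simp)

theorem hasFDerivAt_unbend {q : ℝ × ℝ} (hq : 1 < radius q) :
    HasFDerivAt unbend (stretch (dirX q) (dirY q) (angularFactor q)⁻¹) (bend q) :=
  ((hasStrictFDerivAt_bend_equiv hq).to_local_left_inverse
    (eventually_unbend_bend hq)).hasFDerivAt

theorem contDiffAt_unbend {q : ℝ × ℝ} (hq : 1 < radius q) : ContDiffAt ℝ ω unbend (bend q) := by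
  have h := (contDiffAt_bend (n := ω) (ne_zero_of_radius_pos (one_pos.trans hq))).to_localInverse
    (hasFDerivAt_bend_equiv hq) (by simp)
  exact h.congr_of_eventuallyEq
    ((hasStrictFDerivAt_bend_equiv hq).localInverse_unique (eventually_unbend_bend hq))

theorem isOpen_bend_image {s : Set (ℝ × ℝ)} (hs : IsOpen s) (h : ∀ q ∈ s, 1 < radius q) :
    IsOpen (bend '' s) := by
  rw [isOpen_iff_mem_nhds]
  rintro _ ⟨q, hq, rfl⟩
  rw [← (hasStrictFDerivAt_bend_equiv (h q hq)).map_nhds_eq_of_equiv]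
  exact Filter.image_mem_map (hs.mem_nhds hq)

theorem hasFDerivAt_radius_unbend {q : ℝ × ℝ} (hq : 1 < radius q) :
    HasFDerivAt (fun p => radius (unbend p)) (functional (dirX q) (dirY q)) (bend q) := by
  have h0 := ne_zero_of_radius_pos (one_pos.trans hq)
  have hab := dirX_sq_add_dirY_sq h0
  have h := HasFDerivAt.comp (g := radius) (bend q)
    (by rw [unbend_bend hq]; exact hasFDerivAt_radius h0) (hasFDerivAt_unbend hq)
  refine h.congr_fderiv ?_
  ext <;> simp [stretch]
  · linear_combination dirX q * hab
  · linear_combination dirY q * hab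

theorem hasFDerivAt_dirX_unbend {q : ℝ × ℝ} (hq : 1 < radius q) :
    HasFDerivAt (fun p => dirX (unbend p))
      ((dirY q / (radius q * angularFactor q)) • functional (dirY q) (-dirX q)) (bend q) := by
  have h0 := ne_zero_of_radius_pos (one_pos.trans hq)
  have hr := radius_pos h0
  have hm := angularFactor_pos hq
  have hab := dirX_sq_add_dirY_sq h0
  have h := HasFDerivAt.comp (g := dirX) (bend q)
    (by rw [unbend_bend hq]; exact hasFDerivAt_dirX h0) (hasFDerivAt_unbend hq)
  refine h.congr_fderiv ?_
  ext <;> simp [stretch] <;> field_simp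
  · linear_combination dirY q ^ 2 * hab
  · linear_combination -dirY q * dirX q * hab

theorem hasFDerivAt_dirY_unbend {q : ℝ × ℝ} (hq : 1 < radius q) :
    HasFDerivAt (fun p => dirY (unbend p))
      ((dirX q / (radius q * angularFactor q)) • functional (-dirY q) (dirX q)) (bend q) := by
  have h0 := ne_zero_of_radius_pos (one_pos.trans hq)
  have hr := radius_pos h0
  have hm := angularFactor_pos hq
  have hab := dirX_sq_add_dirY_sq h0
  have h := HasFDerivAt.comp (g := dirY) (bend q)
    (by rw [unbend_bend hq]; exact hasFDerivAt_dirY h0) (hasFDerivAt_unbend hq)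
  refine h.congr_fderiv ?_
  ext <;> simp [stretch] <;> field_simp
  · linear_combination -dirY q * dirX q * hab
  · linear_combination dirX q ^ 2 * hab

/-- The image of the annulus `2 < |q| < 4` under `bend`. -/
noncomputable def bentAnnulus : Set (ℝ × ℝ) := bend '' {q | 2 < radius q ∧ radius q < 4}

/-- The function `1 - d²`, where `d = |q| - 3` is the signed distance from `bend q` to the image
under `bend` of the circle `|q| = 3`. -/
noncomputable def bentSolution (p : ℝ × ℝ) : ℝ := 1 - (radius (unbend p) - 3) ^ 2

theorem hasFDerivAt_bentSolution {q : ℝ × ℝ} (hq : 1 < radius q) :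
    HasFDerivAt bentSolution
      (functional (-2 * (radius q - 3) * dirX q) (-2 * (radius q - 3) * dirY q)) (bend q) := by
  have h := (((hasFDerivAt_radius_unbend hq).sub_const 3).pow 2).const_sub 1
  refine h.congr_fderiv ?_
  ext <;> simp [unbend_bend hq]

theorem pdx_bentSolution {q : ℝ × ℝ} (hq : 1 < radius q) :
    pdx bentSolution (bend q) = -2 * (radius q - 3) * dirX q := by
  simp [pdx_eq_of_hasFDerivAt (hasFDerivAt_bentSolution hq)]

theorem pdy_bentSolution {q : ℝ × ℝ} (hq : 1 < radius q) :
    pdy bentSolution (bend q) = -2 * (radius q - 3) * dirY q := by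
  simp [pdy_eq_of_hasFDerivAt (hasFDerivAt_bentSolution hq)]

theorem eventually_exists_eq_bend {q : ℝ × ℝ} (hq : 1 < radius q) :
    ∀ᶠ p in 𝓝 (bend q), ∃ x, 1 < radius x ∧ bend x = p :=
  (isOpen_bend_image isOpen_one_lt_radius fun _ h => h).eventually_mem ⟨q, hq, rfl⟩

theorem hasFDerivAt_pdx_bentSolution {q : ℝ × ℝ} (hq : 1 < radius q) :
    HasFDerivAt (pdx bentSolution) ((-2 * dirX q) • functional (dirX q) (dirY q) -
      (2 * (radius q - 3) * (dirY q / (radius q * angularFactor q))) •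
        functional (dirY q) (-dirX q)) (bend q) := by
  have h := (((hasFDerivAt_radius_unbend hq).sub_const 3).const_mul (-2)).mul
    (hasFDerivAt_dirX_unbend hq)
  refine (h.congr_of_eventuallyEq ?_).congr_fderiv ?_
  · filter_upwards [eventually_exists_eq_bend hq] with p hp
    obtain ⟨x, hx, rfl⟩ := hp
    simp [pdx_bentSolution hx, unbend_bend hx]
  · ext <;> simp [unbend_bend hq] <;> ring

theorem hasFDerivAt_pdy_bentSolution {q : ℝ × ℝ} (hq : 1 < radius q) :
    HasFDerivAt (pdy bentSolution) ((-2 * dirY q) • functional (dirX q) (dirY q) -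
      (2 * (radius q - 3) * (dirX q / (radius q * angularFactor q))) •
        functional (-dirY q) (dirX q)) (bend q) := by
  have h := (((hasFDerivAt_radius_unbend hq).sub_const 3).const_mul (-2)).mul
    (hasFDerivAt_dirY_unbend hq)
  refine (h.congr_of_eventuallyEq ?_).congr_fderiv ?_
  · filter_upwards [eventually_exists_eq_bend hq] with p hp
    obtain ⟨x, hx, rfl⟩ := hp
    simp [pdy_bentSolution hx, unbend_bend hx]
  · ext <;> simp [unbend_bend hq] <;> ring

theorem hessDet_add_lap_bentSolution {q : ℝ × ℝ} (hq : 1 < radius q) :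
    hessDet bentSolution (bend q) + 2 * lap bentSolution (bend q) + 4 = 0 := by
  have hab := dirX_sq_add_dirY_sq (ne_zero_of_radius_pos (one_pos.trans hq))
  simp only [hessDet, lap, pdx_eq_of_hasFDerivAt (hasFDerivAt_pdx_bentSolution hq),
    pdx_eq_of_hasFDerivAt (hasFDerivAt_pdy_bentSolution hq),
    pdy_eq_of_hasFDerivAt (hasFDerivAt_pdy_bentSolution hq)]
  simp [div_eq_mul_inv]
  generalize (angularFactor q)⁻¹ * (radius q)⁻¹ = k
  generalize dirX q = a at *
  generalize dirY q = b at *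
  have e : b ^ 2 = 1 - a ^ 2 := by linarith
  have e4 : b ^ 4 = (1 - a ^ 2) ^ 2 := by rw [← e]; ring
  ring_nf
  simp only [e, e4]
  ring

theorem analyticAt_bentSolution {q : ℝ × ℝ} (hq : 1 < radius q) :
    AnalyticAt ℝ bentSolution (bend q) := by
  have h0 := ne_zero_of_radius_pos (one_pos.trans hq)
  have h : ContDiffAt ℝ ω (fun p => radius (unbend p)) (bend q) :=
    ContDiffAt.comp (g := radius) (bend q)
      (by rw [unbend_bend hq]; exact contDiffAt_radius h0) (contDiffAt_unbend hq)
  exact (contDiffAt_const.sub ((h.sub contDiffAt_const).pow 2)).analyticAt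

theorem isOpen_bentAnnulus : IsOpen bentAnnulus :=
  isOpen_bend_image ((isOpen_lt continuous_const continuous_radius).inter
    (isOpen_lt continuous_radius continuous_const)) fun _ h => one_lt_two.trans h.1

theorem abs_fst_le_radius (q : ℝ × ℝ) : |q.1| ≤ radius q :=
  Real.abs_le_sqrt (by nlinarith [sq_nonneg q.2])

theorem abs_snd_le_radius (q : ℝ × ℝ) : |q.2| ≤ radius q :=
  Real.abs_le_sqrt (by nlinarith [sq_nonneg q.1])

theorem isCompact_bend_image_closed_annulus :
    IsCompact (bend '' {q | 2 ≤ radius q ∧ radius q ≤ 4}) := by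
  refine IsCompact.image_of_continuousOn ?_ fun q hq =>
    (contDiffAt_bend (n := 0) (ne_zero_of_radius_pos
      (two_pos.trans_le hq.1))).continuousAt.continuousWithinAt
  refine Metric.isCompact_of_isClosed_isBounded
    ((isClosed_le continuous_const continuous_radius).inter
      (isClosed_le continuous_radius continuous_const))
    ((Metric.isBounded_closedBall (x := (0 : ℝ × ℝ)) (r := 4)).subset fun q hq => ?_)
  rw [mem_closedBall_zero_iff, Prod.norm_def]
  exact max_le ((abs_fst_le_radius q).trans hq.2) ((abs_snd_le_radius q).trans hq.2)

theorem closure_bentAnnulus_subset :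
    closure bentAnnulus ⊆ bend '' {q | 2 ≤ radius q ∧ radius q ≤ 4} :=
  closure_minimal (image_mono fun _ h => ⟨h.1.le, h.2.le⟩)
    isCompact_bend_image_closed_annulus.isClosed

theorem bentSolution_boundary {p : ℝ × ℝ} (hp : p ∈ frontier bentAnnulus) :
    bentSolution p = 0 ∧ √((pdx bentSolution p) ^ 2 + (pdy bentSolution p) ^ 2) = 2 := by
  rw [isOpen_bentAnnulus.frontier_eq] at hp
  obtain ⟨q, ⟨h2, h4⟩, rfl⟩ := closure_bentAnnulus_subset hp.1
  have hq : 1 < radius q := one_lt_two.trans_le h2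
  have hab := dirX_sq_add_dirY_sq (ne_zero_of_radius_pos (one_pos.trans hq))
  have hd : (radius q - 3) ^ 2 = 1 := by
    by_contra hne
    refine hp.2 ⟨q, ⟨lt_of_le_of_ne h2 fun h => hne ?_, lt_of_le_of_ne h4 fun h => hne ?_⟩, rfl⟩
    · rw [← h]; norm_num
    · rw [h]; norm_num
  refine ⟨by rw [bentSolution, unbend_bend hq, hd, sub_self], ?_⟩
  rw [pdx_bentSolution hq, pdy_bentSolution hq, Real.sqrt_eq_iff_mul_self_eq (by positivity)
    (by norm_num)]
  linear_combination 4 * (radius q - 3) ^ 2 * hab + 4 * hd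

theorem radius_two_smul (q : ℝ × ℝ) : radius ((2 : ℝ) • q) = 2 * radius q := by
  rw [radius, radius, ← Real.sqrt_sq (zero_le_two (α := ℝ)), ← Real.sqrt_mul (by positivity)]
  congr 1
  simp
  ring

theorem mem_annulus_iff (q : ℝ × ℝ) :
    1 < q.1 ^ 2 + q.2 ^ 2 ∧ q.1 ^ 2 + q.2 ^ 2 < 4 ↔
      2 < radius ((2 : ℝ) • q) ∧ radius ((2 : ℝ) • q) < 4 := by
  have h0 : 0 ≤ radius q := Real.sqrt_nonneg _
  rw [radius_two_smul, ← radius_sq]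
  constructor <;> rintro ⟨h1, h2⟩ <;> constructor <;> nlinarith

theorem bentAnnulus_diffeomorphic_annulus :
    ∃ f g : ℝ × ℝ → ℝ × ℝ,
      ContDiffOn ℝ (⊤ : ℕ∞) f bentAnnulus ∧
      ContDiffOn ℝ (⊤ : ℕ∞) g {q : ℝ × ℝ | 1 < q.1 ^ 2 + q.2 ^ 2 ∧ q.1 ^ 2 + q.2 ^ 2 < 4} ∧
      f '' bentAnnulus = {q : ℝ × ℝ | 1 < q.1 ^ 2 + q.2 ^ 2 ∧ q.1 ^ 2 + q.2 ^ 2 < 4} ∧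
      (∀ p ∈ bentAnnulus, g (f p) = p) ∧
      (∀ q ∈ {q : ℝ × ℝ | 1 < q.1 ^ 2 + q.2 ^ 2 ∧ q.1 ^ 2 + q.2 ^ 2 < 4}, f (g q) = q) := by
  have hfg : ∀ q ∈ {q : ℝ × ℝ | 1 < q.1 ^ 2 + q.2 ^ 2 ∧ q.1 ^ 2 + q.2 ^ 2 < 4},
      (2 : ℝ)⁻¹ • unbend (bend ((2 : ℝ) • q)) = q := fun q hq => by
    rw [unbend_bend (one_lt_two.trans ((mem_annulus_iff q).1 hq).1), smul_smul]
    norm_num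
  refine ⟨fun p => (2 : ℝ)⁻¹ • unbend p, fun q => bend ((2 : ℝ) • q), ?_, ?_, ?_, ?_, hfg⟩
  · rintro _ ⟨q, hq, rfl⟩
    exact (((contDiffAt_unbend (one_lt_two.trans hq.1)).of_le le_top).const_smul
      (2 : ℝ)⁻¹).contDiffWithinAt
  · intro q hq
    have h0 := ne_zero_of_radius_pos (two_pos.trans ((mem_annulus_iff q).1 hq).1)
    exact (ContDiffAt.comp (g := bend) q (contDiffAt_bend h0)
      (contDiffAt_id.const_smul (2 : ℝ))).contDiffWithinAt
  · ext q
    constructor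
    · rintro ⟨_, ⟨x, hx, rfl⟩, rfl⟩
      simp only [mem_ofPred_eq, mem_annulus_iff, unbend_bend (one_lt_two.trans hx.1)]
      simpa [smul_smul] using hx
    · exact fun hq => ⟨bend ((2 : ℝ) • q), ⟨_, (mem_annulus_iff q).1 hq, rfl⟩, hfg q hq⟩
  · rintro _ ⟨q, hq, rfl⟩
    simp [unbend_bend (one_lt_two.trans hq.1), smul_smul]

theorem radius_smul_cos_sin {r : ℝ} (hr : 0 ≤ r) (t : ℝ) :
    radius (r * Real.cos t, r * Real.sin t) = r := by
  have : (r * Real.cos t) ^ 2 + (r * Real.sin t) ^ 2 = r ^ 2 := by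
    linear_combination r ^ 2 * Real.cos_sq_add_sin_sq t
  rw [radius, this, Real.sqrt_sq hr]

theorem bentAnnulus_not_simplyConnected : ¬SimplyConnectedSpace bentAnnulus := by
  have := isOpen_bentAnnulus.locallyPathConnectedSpace
  have hcont : Continuous fun p : bentAnnulus => unbend p := by
    rw [continuous_iff_continuousAt]
    rintro ⟨_, q, hq, rfl⟩
    exact ContinuousAt.comp (g := unbend)
      (contDiffAt_unbend (one_lt_two.trans hq.1)).continuousAt continuousAt_subtype_val
  have hne : ∀ p : bentAnnulus, ((unbend p).1 : ℂ) + (unbend p).2 * Complex.I ≠ 0 := by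
    rintro ⟨_, q, hq, rfl⟩ h
    rw [unbend_bend (one_lt_two.trans hq.1)] at h
    have h1 := congrArg Complex.re h
    have h2 := congrArg Complex.im h
    simp at h1 h2
    exact ne_zero_of_radius_pos (two_pos.trans hq.1) (Prod.ext h1 h2)
  have hr := radius_smul_cos_sin (r := 3) (by norm_num)
  have hmem : ∀ t : ℝ, bend (3 * Real.cos t, 3 * Real.sin t) ∈ bentAnnulus := fun t =>
    ⟨_, by rw [mem_ofPred_eq, hr]; norm_num, rfl⟩
  refine not_simplyConnectedSpace_of_winding_loop
    ⟨fun p => ⟨((unbend p).1 : ℂ) + (unbend p).2 * Complex.I, hne p⟩, by fun_prop⟩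
    (fun t => ⟨bend (3 * Real.cos t, 3 * Real.sin t), hmem t⟩) ?_ (by simp) 3 fun t => ?_
  · refine Continuous.subtype_mk (continuous_iff_continuousAt.2 fun t => ?_) hmem
    refine ContinuousAt.comp (g := bend) (contDiffAt_bend (n := 0)
      (ne_zero_of_radius_pos (by rw [hr]; norm_num))).continuousAt ?_
    fun_prop
  · simp only [ContinuousMap.coe_mk, unbend_bend (q := (3 * Real.cos t, 3 * Real.sin t))
      (by rw [hr]; norm_num), Complex.exp_mul_I]
    push_cast
    ring

theorem bend_axis {x : ℝ} (hx : x ≠ 0) : bend (x, 0) = (x + x / |x| / 4, 0) := by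
  have hr : radius (x, 0) = |x| := by simp [radius, Real.sqrt_sq_eq_abs]
  have : x / |x| = 1 ∨ x / |x| = -1 := by
    rcases abs_choice x with h | h <;> rw [h] <;> [left; right] <;> field_simp
  simp only [bend, dirX, dirY, hr]
  rcases this with h | h <;> rw [h] <;> norm_num

theorem abs_snd_lt_of_mem_bentAnnulus {p : ℝ × ℝ} (hp : p ∈ bentAnnulus) : |p.2| < 4 := by
  obtain ⟨q, hq, rfl⟩ := hp
  have h0 := ne_zero_of_radius_pos (two_pos.trans hq.1)
  have hab := dirX_sq_add_dirY_sq h0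
  have e : (bend q).2 = q.2 * (1 - dirX q ^ 2 / (4 * radius q)) := by
    have := radius_pos h0
    simp only [bend, dirY]
    field_simp
  have hk : dirX q ^ 2 / (4 * radius q) ≤ 1 := by
    rw [div_le_one (by linarith [hq.1])]
    nlinarith [sq_nonneg (dirY q), hq.1]
  have hk0 : 0 ≤ dirX q ^ 2 / (4 * radius q) :=
    div_nonneg (sq_nonneg _) (by linarith [hq.1])
  rw [e, abs_mul]
  calc |q.2| * |1 - dirX q ^ 2 / (4 * radius q)| ≤ |q.2| * 1 := by
        gcongr
        rw [abs_le]
        constructor <;> linarith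
    _ < 4 := by linarith [abs_snd_le_radius q, hq.2]

theorem bentAnnulus_not_rotation_symmetric : ¬∃ z : ℝ × ℝ, ∀ θ : ℝ,
    (fun q : ℝ × ℝ =>
      (z.1 + Real.cos θ * (q.1 - z.1) - Real.sin θ * (q.2 - z.2),
       z.2 + Real.sin θ * (q.1 - z.1) + Real.cos θ * (q.2 - z.2))) '' bentAnnulus
      = bentAnnulus := by
  rintro ⟨z, hz⟩
  have hmem : ∀ x : ℝ, |x| = 31 / 8 → bend (x, 0) ∈ bentAnnulus := fun x hx =>
    ⟨_, by
      have hr : radius (x, 0) = |x| := by simp [radius, Real.sqrt_sq_eq_abs]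
      rw [mem_ofPred_eq, hr, hx]
      norm_num, rfl⟩
  have hrot : ∀ x : ℝ, |x| = 31 / 8 → |z.2 + ((bend (x, 0)).1 - z.1)| < 4 := fun x hx => by
    have h := (hz (Real.pi / 2)).subset (mem_image_of_mem _ (hmem x hx))
    simpa using abs_snd_lt_of_mem_bentAnnulus h
  have h1 := hrot (31 / 8) (by norm_num)
  have h2 := hrot (-(31 / 8)) (by norm_num)
  rw [bend_axis (by norm_num), abs_lt] at h1 h2
  norm_num at h1 h2
  linarith

/-- If `bentSolution` is radial about `z`, then `bend q - z` is parallel to `q`. -/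
theorem bend_sub_parallel_of_radial {z : ℝ × ℝ}
    (hz : ∀ q₁ ∈ closure bentAnnulus, ∀ q₂ ∈ closure bentAnnulus,
      (q₁.1 - z.1) ^ 2 + (q₁.2 - z.2) ^ 2 = (q₂.1 - z.1) ^ 2 + (q₂.2 - z.2) ^ 2 →
      bentSolution q₁ = bentSolution q₂)
    {q : ℝ × ℝ} (h3 : 3 < radius q) (h4 : radius q < 4) :
    dirX q * ((bend q).2 - z.2) = dirY q * ((bend q).1 - z.1) := by
  have hmem : bend q ∈ bentAnnulus := ⟨q, ⟨by linarith, h4⟩, rfl⟩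
  let c : ℝ → ℝ × ℝ := fun t =>
    (z.1 + Real.cos t * ((bend q).1 - z.1) - Real.sin t * ((bend q).2 - z.2),
      z.2 + Real.sin t * ((bend q).1 - z.1) + Real.cos t * ((bend q).2 - z.2))
  have hc0 : c 0 = bend q := by simp [c]
  have hc : HasDerivAt c (-((bend q).2 - z.2), (bend q).1 - z.1) 0 := by
    have h1 := (((Real.hasDerivAt_cos 0).mul_const ((bend q).1 - z.1)).const_add z.1).sub
      ((Real.hasDerivAt_sin 0).mul_const ((bend q).2 - z.2))
    have h2 := (((Real.hasDerivAt_sin 0).mul_const ((bend q).1 - z.1)).const_add z.2).add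
      ((Real.hasDerivAt_cos 0).mul_const ((bend q).2 - z.2))
    exact (h1.prodMk h2).congr_deriv (by simp)
  have hu := HasFDerivAt.comp_hasDerivAt (l := bentSolution) 0
    (by rw [hc0]; exact hasFDerivAt_bentSolution (by linarith)) hc
  have hconst : bentSolution ∘ c =ᶠ[𝓝 0] fun _ => bentSolution (bend q) := by
    have hopen : ∀ᶠ t in 𝓝 0, c t ∈ bentAnnulus :=
      hc.continuousAt.eventually_mem (isOpen_bentAnnulus.mem_nhds (by rwa [hc0]))
    filter_upwards [hopen] with t ht
    refine hz _ (subset_closure ht) _ (subset_closure hmem) ?_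
    simp only [c]
    linear_combination (((bend q).1 - z.1) ^ 2 + ((bend q).2 - z.2) ^ 2) *
      Real.cos_sq_add_sin_sq t
  have h0 := hu.unique ((hasDerivAt_const (0 : ℝ) _).congr_of_eventuallyEq hconst)
  simp only [functional_apply] at h0
  have : (radius q - 3) * (dirX q * ((bend q).2 - z.2) - dirY q * ((bend q).1 - z.1)) = 0 := by
    linarith
  rcases mul_eq_zero.1 this with h | h <;> linarith

theorem bentSolution_not_radial : ¬∃ z : ℝ × ℝ, ∀ q₁ ∈ closure bentAnnulus,
    ∀ q₂ ∈ closure bentAnnulus,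
      (q₁.1 - z.1) ^ 2 + (q₁.2 - z.2) ^ 2 = (q₂.1 - z.1) ^ 2 + (q₂.2 - z.2) ^ 2 →
      bentSolution q₁ = bentSolution q₂ := by
  rintro ⟨z, hz⟩
  have key : ∀ a b : ℝ, a ^ 2 + b ^ 2 = 1 →
      a * (7 / 2 * b - a ^ 2 * b / 4 - z.2) =
        b * (7 / 2 * a + (2 * a - a ^ 3) / 4 - z.1) := fun a b hab => by
    have hr : radius (7 / 2 * a, 7 / 2 * b) = 7 / 2 := by
      have : (7 / 2 * a) ^ 2 + (7 / 2 * b) ^ 2 = (7 / 2) ^ 2 := by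
        linear_combination (7 / 2) ^ 2 * hab
      rw [radius, this, Real.sqrt_sq (by norm_num)]
    have h := bend_sub_parallel_of_radial hz (q := (7 / 2 * a, 7 / 2 * b))
      (by rw [hr]; norm_num) (by rw [hr]; norm_num)
    simpa [bend, dirX, dirY, hr] using h
  have h1 := key 1 0 (by norm_num)
  have h2 := key 0 1 (by norm_num)
  have h3 := key (3 / 5) (4 / 5) (by norm_num)
  norm_num at h1 h2 h3
  linarith

/-- **Example (necessity of simple connectedness).** There exist a bounded open set
`Ω ⊂ ℝ²` diffeomorphic to an annulus (in particular not simply connected) and not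
rotationally symmetric about any point, and a real analytic function `u` on a
neighborhood of `closure Ω`, positive on `Ω` and not radial about any point, with
`det D²u + 2Δu + 4 = 0` in `Ω` and `u = 0`, `|Du| = 2` on `∂Ω`. -/
theorem annulus_counterexample_exists :
    ∃ (Ω : Set (ℝ × ℝ)) (u : ℝ × ℝ → ℝ),
      IsOpen Ω ∧ Bornology.IsBounded Ω ∧
      -- `Ω` is diffeomorphic to the standard annulus `{1 < |q| < 2}`
      (∃ f g : ℝ × ℝ → ℝ × ℝ,
        ContDiffOn ℝ (⊤ : ℕ∞) f Ω ∧
        ContDiffOn ℝ (⊤ : ℕ∞) g {q : ℝ × ℝ | 1 < q.1 ^ 2 + q.2 ^ 2 ∧ q.1 ^ 2 + q.2 ^ 2 < 4} ∧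
        f '' Ω = {q : ℝ × ℝ | 1 < q.1 ^ 2 + q.2 ^ 2 ∧ q.1 ^ 2 + q.2 ^ 2 < 4} ∧
        (∀ p ∈ Ω, g (f p) = p) ∧
        (∀ q ∈ {q : ℝ × ℝ | 1 < q.1 ^ 2 + q.2 ^ 2 ∧ q.1 ^ 2 + q.2 ^ 2 < 4}, f (g q) = q)) ∧
      -- in particular `Ω` is not simply connected
      ¬SimplyConnectedSpace Ω ∧
      -- `Ω` is not rotationally symmetric about any point
      (¬∃ z : ℝ × ℝ, ∀ θ : ℝ,
        (fun q : ℝ × ℝ =>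
          (z.1 + Real.cos θ * (q.1 - z.1) - Real.sin θ * (q.2 - z.2),
           z.2 + Real.sin θ * (q.1 - z.1) + Real.cos θ * (q.2 - z.2))) '' Ω = Ω) ∧
      -- `u` is real analytic on an open neighborhood of `closure Ω`
      (∃ V : Set (ℝ × ℝ), IsOpen V ∧ closure Ω ⊆ V ∧ AnalyticOnNhd ℝ u V) ∧
      -- `u` is positive on `Ω`
      (∀ p ∈ Ω, 0 < u p) ∧
      -- `u` is not radial with respect to any point
      (¬∃ z : ℝ × ℝ, ∀ q₁ ∈ closure Ω, ∀ q₂ ∈ closure Ω,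
        (q₁.1 - z.1) ^ 2 + (q₁.2 - z.2) ^ 2 = (q₂.1 - z.1) ^ 2 + (q₂.2 - z.2) ^ 2 →
        u q₁ = u q₂) ∧
      -- the overdetermined problem
      (∀ p ∈ Ω, hessDet u p + 2 * lap u p + 4 = 0) ∧
      (∀ p ∈ frontier Ω, u p = 0 ∧ Real.sqrt ((pdx u p) ^ 2 + (pdy u p) ^ 2) = 2) := by
  refine ⟨bentAnnulus, bentSolution, isOpen_bentAnnulus,
    isCompact_bend_image_closed_annulus.isBounded.subset
      (subset_closure.trans closure_bentAnnulus_subset),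
    bentAnnulus_diffeomorphic_annulus, bentAnnulus_not_simplyConnected,
    bentAnnulus_not_rotation_symmetric,
    ⟨bend '' {q | 1 < radius q}, isOpen_bend_image isOpen_one_lt_radius fun _ h => h,
      closure_bentAnnulus_subset.trans (image_mono fun _ h => one_lt_two.trans_le h.1), ?_⟩,
    ?_, bentSolution_not_radial, ?_, fun _ => bentSolution_boundary⟩
  · rintro _ ⟨q, hq, rfl⟩
    exact analyticAt_bentSolution hq
  · rintro _ ⟨q, hq, rfl⟩
    rw [bentSolution, unbend_bend (one_lt_two.trans hq.1)]
    nlinarith [hq.1, hq.2]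
  · rintro _ ⟨q, hq, rfl⟩
    exact hessDet_add_lap_bentSolution (one_lt_two.trans hq.1)
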